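/- Let 0<q<1. For (j,k,l) ∈ ℤ³ define d(j,k,l) := q^{2(j+k+l)} q^{2(j−l)} [j,k,l]! if j,k,l ≥ 0 and d(j,k,l) := 0 otherwise. Then for all natural numbers j,k,l with j+k+l ≥ 1, one has d(j,k,l) = q⁴ d(j−1,k,l) + q^{−2j+2} d(j,k−1,l) + q^{−2(j+k)} d(j,k,l−1). -/

import Mathlib

open scoped BigOperators

/-- The `q`-number `[x] = (q^x - q^(-x))/(q - q⁻¹)`. -/
noncomputable def qNum (q x : ℝ) : ℝ := (q ^ x - q ^ (-x)) / (q - q⁻¹)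

/-- The `q`-factorial `[n]! = [n][n-1]⋯[1]`, with `[0]! = 1`. -/
noncomputable def qFact (q : ℝ) (n : ℕ) : ℝ := ∏ i ∈ Finset.range n, qNum q (i + 1)

/-- The `q`-trinomial coefficient `[j,k,l]! = q^{-(jk+kl+lj)} [j+k+l]!/([j]![k]![l]!)`. -/
noncomputable def qTrinom (q : ℝ) (j k l : ℕ) : ℝ :=
  q ^ (-((j * k + k * l + l * j : ℕ) : ℝ)) * qFact q (j + k + l) /
    (qFact q j * qFact q k * qFact q l)

/-- `d(j,k,l) = q^{2(j+k+l)} q^{2(j-l)} [j,k,l]!` if `j,k,l ≥ 0` and `0` otherwise. -/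
noncomputable def dExt (q : ℝ) (j k l : ℤ) : ℝ :=
  if 0 ≤ j ∧ 0 ≤ k ∧ 0 ≤ l then
    q ^ (2 * ((j : ℝ) + (k : ℝ) + (l : ℝ))) * q ^ (2 * ((j : ℝ) - (l : ℝ))) *
      qTrinom q j.toNat k.toNat l.toNat
  else 0

theorem qNum_zero (q : ℝ) : qNum q 0 = 0 := by simp [qNum]

theorem qNum_pos {q x : ℝ} (hq : 0 < q) (hq1 : q < 1) (hx : 0 < x) : 0 < qNum q x := by
  unfold qNum
  apply div_pos_of_neg_of_neg
  · rw [sub_neg]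
    exact Real.rpow_lt_rpow_of_exponent_gt hq hq1 (by linarith)
  · rw [sub_neg]
    exact hq1.trans ((one_lt_inv₀ hq).2 hq1)

theorem qFact_succ (q : ℝ) (n : ℕ) : qFact q (n + 1) = qFact q n * qNum q (n + 1) := by
  simp [qFact, Finset.prod_range_succ]

theorem qFact_pos {q : ℝ} (hq : 0 < q) (hq1 : q < 1) (n : ℕ) : 0 < qFact q n :=
  Finset.prod_pos fun _ _ => qNum_pos hq hq1 (by positivity)

/-- Additivity of `q`-numbers, twisted by powers of `q`. -/
theorem qNum_add_add {q : ℝ} (hq : 0 < q) (x y z : ℝ) :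
    qNum q (x + y + z) =
      q ^ (y + z) * qNum q x + q ^ (z - x) * qNum q y + q ^ (-(x + y)) * qNum q z := by
  simp only [qNum, mul_div_assoc', ← add_div, mul_sub, ← Real.rpow_add hq]
  ring_nf

theorem dExt_natCast {q : ℝ} (hq : 0 < q) (j k l : ℕ) :
    dExt q j k l =
      q ^ (4 * (j : ℝ) + 2 * k - (j * k + k * l + l * j)) *
        (qFact q (j + k + l) / (qFact q j * qFact q k * qFact q l)) := by
  have h : q ^ (4 * (j : ℝ) + 2 * k - (j * k + k * l + l * j)) =
      q ^ (2 * ((j : ℝ) + k + l)) * q ^ (2 * ((j : ℝ) - l)) *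
        q ^ (-((j * k + k * l + l * j : ℕ) : ℝ)) := by
    rw [← Real.rpow_add hq, ← Real.rpow_add hq]
    push_cast
    ring_nf
  simp only [dExt, qTrinom, Int.natCast_nonneg, and_self, if_true, Int.toNat_natCast,
    Int.cast_natCast, h]
  ring

theorem dExt_sub_one_left {q : ℝ} (hq : 0 < q) (hq1 : q < 1) (j k l : ℕ) :
    q ^ (4 : ℕ) * dExt q ((j : ℤ) - 1) k l * qNum q (j + k + l) =
      q ^ ((k : ℝ) + l) * qNum q j * dExt q j k l := by
  cases j with
  | zero => simp [dExt, qNum_zero]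
  | succ j =>
    rw [show ((j + 1 : ℕ) : ℤ) - 1 = (j : ℤ) by simp, dExt_natCast hq, dExt_natCast hq,
      show j + 1 + k + l = j + k + l + 1 by ring, qFact_succ, qFact_succ]
    have hj := (qFact_pos hq hq1 j).ne'
    have hk := (qFact_pos hq hq1 k).ne'
    have hl := (qFact_pos hq hq1 l).ne'
    have hn := (qNum_pos hq hq1 (x := (j : ℝ) + 1) (by positivity)).ne'
    have h : q ^ (4 : ℕ) * q ^ (4 * (j : ℝ) + 2 * k - (j * k + k * l + l * j)) =
        q ^ ((k : ℝ) + l) *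
          q ^ (4 * ((j : ℝ) + 1) + 2 * k - (((j : ℝ) + 1) * k + k * l + l * (j + 1))) := by
      rw [← Real.rpow_natCast q 4, ← Real.rpow_add hq, ← Real.rpow_add hq]
      push_cast
      ring_nf
    push_cast
    rw [show (j : ℝ) + 1 + k + l = j + k + l + 1 by ring, ← mul_assoc, h]
    field_simp

theorem dExt_sub_one_middle {q : ℝ} (hq : 0 < q) (hq1 : q < 1) (j k l : ℕ) :
    q ^ (-(2 * (j : ℝ)) + 2) * dExt q j ((k : ℤ) - 1) l * qNum q (j + k + l) =
      q ^ ((l : ℝ) - j) * qNum q k * dExt q j k l := by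
  cases k with
  | zero => simp [dExt, qNum_zero]
  | succ k =>
    rw [show ((k + 1 : ℕ) : ℤ) - 1 = (k : ℤ) by simp, dExt_natCast hq, dExt_natCast hq,
      show j + (k + 1) + l = j + k + l + 1 by ring, qFact_succ, qFact_succ]
    have hj := (qFact_pos hq hq1 j).ne'
    have hk := (qFact_pos hq hq1 k).ne'
    have hl := (qFact_pos hq hq1 l).ne'
    have hn := (qNum_pos hq hq1 (x := (k : ℝ) + 1) (by positivity)).ne'
    have h : q ^ (-(2 * (j : ℝ)) + 2) * q ^ (4 * (j : ℝ) + 2 * k - (j * k + k * l + l * j)) =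
        q ^ ((l : ℝ) - j) *
          q ^ (4 * (j : ℝ) + 2 * ((k : ℝ) + 1) - (j * ((k : ℝ) + 1) + (k + 1) * l + l * j)) := by
      rw [← Real.rpow_add hq, ← Real.rpow_add hq]
      ring_nf
    push_cast
    rw [show (j : ℝ) + (k + 1) + l = j + k + l + 1 by ring, ← mul_assoc, h]
    field_simp

theorem dExt_sub_one_right {q : ℝ} (hq : 0 < q) (hq1 : q < 1) (j k l : ℕ) :
    q ^ (-(2 * ((j : ℝ) + (k : ℝ)))) * dExt q j k ((l : ℤ) - 1) * qNum q (j + k + l) =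
      q ^ (-((j : ℝ) + k)) * qNum q l * dExt q j k l := by
  cases l with
  | zero => simp [dExt, qNum_zero]
  | succ l =>
    rw [show ((l + 1 : ℕ) : ℤ) - 1 = (l : ℤ) by simp, dExt_natCast hq, dExt_natCast hq,
      ← add_assoc, qFact_succ, qFact_succ]
    have hj := (qFact_pos hq hq1 j).ne'
    have hk := (qFact_pos hq hq1 k).ne'
    have hl := (qFact_pos hq hq1 l).ne'
    have hn := (qNum_pos hq hq1 (x := (l : ℝ) + 1) (by positivity)).ne'
    have h : q ^ (-(2 * ((j : ℝ) + k))) *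
          q ^ (4 * (j : ℝ) + 2 * k - (j * k + k * l + l * j)) =
        q ^ (-((j : ℝ) + k)) *
          q ^ (4 * (j : ℝ) + 2 * k - (j * k + k * ((l : ℝ) + 1) + (l + 1) * j)) := by
      rw [← Real.rpow_add hq, ← Real.rpow_add hq]
      ring_nf
    push_cast
    rw [← add_assoc, ← mul_assoc, h]
    field_simp

theorem statement4
    (q : ℝ) (hq : 0 < q) (hq1 : q < 1) :
    ∀ j k l : ℕ, 1 ≤ j + k + l →
      dExt q j k l =
        q ^ (4 : ℕ) * dExt q ((j : ℤ) - 1) k l +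
        q ^ (-(2 * (j : ℝ)) + 2) * dExt q j ((k : ℤ) - 1) l +
        q ^ (-(2 * ((j : ℝ) + (k : ℝ)))) * dExt q j k ((l : ℤ) - 1) := by
  intro j k l hjkl
  have hN : (0 : ℝ) < j + k + l := by exact_mod_cast hjkl
  apply mul_right_cancel₀ (qNum_pos hq hq1 hN).ne'
  rw [add_mul, add_mul, dExt_sub_one_left hq hq1, dExt_sub_one_middle hq hq1,
    dExt_sub_one_right hq hq1, qNum_add_add hq]
  ring
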